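/- Let q ≥ 2 and d ≥ 1 with d dividing q, let r ≥ 2, and let a, j be integers with 0 ≤ a < d and 0 ≤ j < q. Then #{0 ≤ n < q^r : n ≡ a (mod d) and s_q(n) ≡ j (mod q)} = q^{r−1}/d exactly. -/

import Mathlib

theorem sum_range_mul_eq_sum_sum (f : ℕ → ℕ) (N q : ℕ) :
    ∑ n ∈ Finset.range (N * q), f n =
      ∑ m ∈ Finset.range N, ∑ c ∈ Finset.range q, f (c + q * m) := by
  induction N with
  | zero => simp
  | succ N ih =>
    rw [Nat.succ_mul, Finset.sum_range_add, ih, Finset.sum_range_succ]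
    simp only [Nat.mul_comm, Nat.add_comm]

/-- Each residue `j` modulo `q` is attained exactly once by `t + c` with `c < q`. -/
theorem sum_range_ite_add_mod_eq_one (q t j : ℕ) (hj : j < q) :
    ∑ c ∈ Finset.range q, (if (t + c) % q = j then 1 else 0) = 1 := by
  have hu : t % q < q := Nat.mod_lt _ (by omega)
  have key : ∀ c ∈ Finset.range q, ((t + c) % q = j ↔
      (if t % q ≤ j then j - t % q else j + q - t % q) = c) := by
    intro c hc
    rw [Finset.mem_range] at hc
    rw [← Nat.mod_add_mod]
    rcases Nat.lt_or_ge (t % q + c) q with h | h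
    · rw [Nat.mod_eq_of_lt h]
      split_ifs <;> omega
    · rw [Nat.mod_eq_sub_mod h, Nat.mod_eq_of_lt (by omega)]
      split_ifs <;> omega
  rw [Finset.sum_congr rfl fun c hc => if_congr (key c hc) rfl rfl, Finset.sum_ite_eq,
    if_pos]
  rw [Finset.mem_range]
  split_ifs <;> omega

theorem digits_sum_add_mul (q c m : ℕ) (hq : 2 ≤ q) (hc : c < q) :
    (Nat.digits q (c + q * m)).sum = c + (Nat.digits q m).sum := by
  by_cases h : c = 0 ∧ m = 0
  · simp [h.1, h.2]
  · rw [Nat.digits_add q hq c m hc (by omega), List.sum_cons]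

theorem sum_range_pow_ite_digits_sum (q k t j : ℕ) (hq : 2 ≤ q) (hj : j < q) :
    ∑ n ∈ Finset.range (q ^ (k + 1)),
      (if (t + (Nat.digits q n).sum) % q = j then 1 else 0) = q ^ k := by
  rw [pow_succ, sum_range_mul_eq_sum_sum, Finset.sum_congr rfl (g := fun _ => 1)]
  · simp
  · intro m _
    refine Eq.trans (Finset.sum_congr rfl fun c hc => ?_)
      (sum_range_ite_add_mod_eq_one q (t + (Nat.digits q m).sum) j hj)
    rw [digits_sum_add_mul q c m hq (Finset.mem_range.mp hc), add_assoc, add_comm c]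

theorem sum_range_mul_ite_mod_eq (e d a : ℕ) (ha : a < d) :
    ∑ c ∈ Finset.range (e * d), (if c % d = a then 1 else 0) = e := by
  rw [sum_range_mul_eq_sum_sum, Finset.sum_congr rfl (g := fun _ => 1)]
  · simp
  · intro m _
    simpa using sum_range_ite_add_mod_eq_one d 0 a ha

/-- For `d ∣ q` and `r ≥ 2`, the number of `n < q^r` with `n ≡ a (mod d)` and
`s_q(n) ≡ j (mod q)` equals exactly `q^{r-1}/d`. -/
theorem count_block_eq (q d r : ℕ) (hq : 2 ≤ q) (hd : 1 ≤ d) (hdq : d ∣ q)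
    (hr : 2 ≤ r) (a j : ℕ) (ha : a < d) (hj : j < q) :
    ((((Finset.range (q ^ r)).filter
          (fun n => n % d = a ∧ (Nat.digits q n).sum % q = j)).card : ℚ) =
      (q : ℚ) ^ (r - 1) / d) := by
  obtain ⟨k, rfl⟩ : ∃ k, r = k + 1 + 1 := ⟨r - 2, by omega⟩
  obtain ⟨e, he⟩ := hdq
  have hcard : ((Finset.range (q ^ (k + 1 + 1))).filter
      (fun n => n % d = a ∧ (Nat.digits q n).sum % q = j)).card = e * q ^ k := by
    rw [Finset.card_filter, pow_succ, sum_range_mul_eq_sum_sum, Finset.sum_comm]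
    calc _ = ∑ c ∈ Finset.range q, (if c % d = a then 1 else 0) * q ^ k := by
          refine Finset.sum_congr rfl fun c hc => ?_
          rw [← sum_range_pow_ite_digits_sum q k c j hq hj, Finset.mul_sum]
          refine Finset.sum_congr rfl fun m _ => ?_
          have hmod : (c + q * m) % d = c % d := by
            rw [he, mul_assoc, Nat.add_mul_mod_self_left]
          rw [digits_sum_add_mul q c m hq (Finset.mem_range.mp hc), hmod, ite_and]
          split_ifs <;> simp
      _ = e * q ^ k := by
          rw [← Finset.sum_mul, he, mul_comm d e, sum_range_mul_ite_mod_eq e d a ha]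
  have hd0 : (d : ℚ) ≠ 0 := by exact_mod_cast (by omega : d ≠ 0)
  have heq : (q : ℚ) = d * e := by exact_mod_cast he
  rw [hcard, Nat.add_sub_cancel, eq_div_iff hd0, pow_succ]
  push_cast
  linear_combination -(q : ℚ) ^ k * heq
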